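/- Let R be a commutative ring whose additive group is ℤ-torsion-free, and let Φ be a right exact functor from nilpotent R-algebras to abelian groups. Assume that (1) Φ is exact on short exact sequences of nilpotent R-algebras whose underlying additive groups are ℚ-vector spaces (i.e., on nilpotent R⊗ℚ-algebras), and (2) Φ is exact on short exact sequences of nilpotent R-algebras N satisfying N² = 0. Then Φ is exact on all short exact sequences of nilpotent R-algebras. -/

import Mathlib

universe u v

/-- Product of `n+1` elements of a (possibly non-unital) multiplicative structure. -/
def nprod {N : Type u} [Mul N] : (n : ℕ) → (Fin (n + 1) → N) → N
  | 0, f => f 0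
  | n + 1, f => f 0 * nprod n fun i => f i.succ

/-- A bundled nilpotent `R`-algebra: a non-unital commutative `R`-algebra `N`
such that every product of `k` elements vanishes, for some `k ≥ 1`. -/
structure NilpAlg (R : Type u) [CommRing R] : Type (u + 1) where
  carrier : Type u
  [nonUnitalCommRing : NonUnitalCommRing carrier]
  [module : Module R carrier]
  [isScalarTower : IsScalarTower R carrier carrier]
  [smulCommClass : SMulCommClass R carrier carrier]
  nilpotent : ∃ k : ℕ, ∀ f : Fin (k + 1) → carrier, nprod k f = 0

attribute [instance] NilpAlg.nonUnitalCommRing NilpAlg.module NilpAlg.isScalarTower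
  NilpAlg.smulCommClass

variable {R : Type u} [CommRing R]

/-- `0 → N₁ → N₂ → N₃ → 0` is a short exact sequence of nilpotent `R`-algebras
(exactness being measured on underlying modules/additive groups). -/
def IsSES {N₁ N₂ N₃ : NilpAlg R} (i : N₁.carrier →ₙₐ[R] N₂.carrier)
    (p : N₂.carrier →ₙₐ[R] N₃.carrier) : Prop :=
  Function.Injective i ∧ Function.Surjective p ∧ ∀ x : N₂.carrier, p x = 0 ↔ x ∈ Set.range i

/-- A functor from nilpotent `R`-algebras to abelian groups. -/
structure AbFunctor (R : Type u) [CommRing R] : Type (max (u + 1) (v + 1)) where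
  obj : NilpAlg R → Type v
  [addCommGroup : ∀ N, AddCommGroup (obj N)]
  map : ∀ {N₁ N₂ : NilpAlg R}, (N₁.carrier →ₙₐ[R] N₂.carrier) → (obj N₁ →+ obj N₂)
  map_id : ∀ N : NilpAlg R, map (NonUnitalAlgHom.id R N.carrier) = AddMonoidHom.id (obj N)
  map_comp : ∀ {N₁ N₂ N₃ : NilpAlg R} (f : N₁.carrier →ₙₐ[R] N₂.carrier)
    (g : N₂.carrier →ₙₐ[R] N₃.carrier), map (g.comp f) = (map g).comp (map f)

attribute [instance] AbFunctor.addCommGroup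

/-- `Φ` is right exact: every short exact sequence `0 → N₁ → N₂ → N₃ → 0` yields an
exact sequence `Φ(N₁) → Φ(N₂) → Φ(N₃) → 0` of abelian groups. -/
def AbFunctor.RightExact (Φ : AbFunctor.{u, v} R) : Prop :=
  ∀ {N₁ N₂ N₃ : NilpAlg R} (i : N₁.carrier →ₙₐ[R] N₂.carrier)
    (p : N₂.carrier →ₙₐ[R] N₃.carrier), IsSES i p →
      Function.Surjective (Φ.map p) ∧
      ∀ y : Φ.obj N₂, Φ.map p y = 0 ↔ y ∈ Set.range (Φ.map i)

/-- `Φ` is exact on short exact sequences all of whose terms satisfy `P`: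
the induced sequence `0 → Φ(N₁) → Φ(N₂) → Φ(N₃) → 0` is exact. -/
def AbFunctor.ExactOn (Φ : AbFunctor.{u, v} R) (P : NilpAlg R → Prop) : Prop :=
  ∀ {N₁ N₂ N₃ : NilpAlg R}, P N₁ → P N₂ → P N₃ →
    ∀ (i : N₁.carrier →ₙₐ[R] N₂.carrier) (p : N₂.carrier →ₙₐ[R] N₃.carrier), IsSES i p →
      Function.Injective (Φ.map i) ∧ Function.Surjective (Φ.map p) ∧
      ∀ y : Φ.obj N₂, Φ.map p y = 0 ↔ y ∈ Set.range (Φ.map i)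

/-- The additive group underlying `N` is (the additive group of) a `ℚ`-vector space,
i.e. it is uniquely divisible. -/
def IsQVectorSpace (N : Type v) [AddCommGroup N] : Prop :=
  ∀ n : ℤ, n ≠ 0 → Function.Bijective fun x : N => n • x

open TensorProduct

namespace NilpAlg

lemma map_nprod {F A B : Type*} [Mul A] [Mul B] [FunLike F A B] [MulHomClass F A B] (g : F) (k : ℕ)
    (f : Fin (k + 1) → A) : g (nprod k f) = nprod k fun j => g (f j) := by
  induction k with
  | zero => rfl
  | succ k ih => simp only [nprod, map_mul, ih]

/-- A subalgebra of a nilpotent algebra. -/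
def ofSubalgebra (N : NilpAlg R) (S : NonUnitalSubalgebra R N.carrier) : NilpAlg R where
  carrier := S
  nilpotent := by
    obtain ⟨k, hk⟩ := N.nilpotent
    refine ⟨k, fun f => Subtype.ext ?_⟩
    exact (map_nprod (NonUnitalSubalgebraClass.subtype (R := R) S) k f).trans (hk _)

/-- The kernel of a homomorphism of nilpotent algebras. -/
def ker {N M : NilpAlg R} (p : N.carrier →ₙₐ[R] M.carrier) : NilpAlg R :=
  N.ofSubalgebra
    { carrier := {x | p x = 0}
      add_mem' := fun {a b} ha hb => by
        rw [Set.mem_ofPred_eq] at *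
        rw [map_add, ha, hb, add_zero]
      zero_mem' := map_zero p
      mul_mem' := fun {a b} ha hb => by
        rw [Set.mem_ofPred_eq] at *
        rw [map_mul, ha, zero_mul]
      smul_mem' := fun r a ha => by
        rw [Set.mem_ofPred_eq] at *
        rw [map_smul, ha, smul_zero] }

/-- The inclusion of the kernel. -/
def kerι {N M : NilpAlg R} (p : N.carrier →ₙₐ[R] M.carrier) : (ker p).carrier →ₙₐ[R] N.carrier :=
  NonUnitalSubalgebraClass.subtype (R := R) (A := N.carrier) _

lemma kerι_injective {N M : NilpAlg R} (p : N.carrier →ₙₐ[R] M.carrier) :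
    Function.Injective (kerι p) :=
  Subtype.val_injective

lemma mem_range_kerι {N M : NilpAlg R} (p : N.carrier →ₙₐ[R] M.carrier) (x : N.carrier) :
    p x = 0 ↔ x ∈ Set.range (kerι p) :=
  ⟨fun h => ⟨⟨x, h⟩, rfl⟩, by rintro ⟨y, rfl⟩; exact y.2⟩

lemma isSES_ker {N M : NilpAlg R} {p : N.carrier →ₙₐ[R] M.carrier}
    (hp : Function.Surjective p) : IsSES (kerι p) p :=
  ⟨kerι_injective p, hp, mem_range_kerι p⟩

lemma exists_lift {A N M : NilpAlg R} {i : N.carrier →ₙₐ[R] M.carrier}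
    (hi : Function.Injective i) (g : A.carrier →ₙₐ[R] M.carrier)
    (hg : ∀ a, g a ∈ Set.range i) : ∃ l : A.carrier →ₙₐ[R] N.carrier, i.comp l = g := by
  choose l hl using hg
  refine ⟨{ toFun := l
            map_smul' := fun r x => hi ?_
            map_zero' := hi ?_
            map_add' := fun x y => hi ?_
            map_mul' := fun x y => hi ?_ }, NonUnitalAlgHom.ext hl⟩
  · simp [hl]
  · simp [hl]
  · simp [hl]
  · simp [hl]

/-- A module, viewed as an algebra with zero multiplication. -/
def ofModule (M : Type u) [AddCommGroup M] [Module R M] : NilpAlg R :=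
  letI : NonUnitalCommRing M :=
    { (inferInstance : AddCommGroup M) with
      mul := fun _ _ => 0
      left_distrib := fun _ _ _ => (add_zero (0 : M)).symm
      right_distrib := fun _ _ _ => (add_zero (0 : M)).symm
      zero_mul := fun _ => rfl
      mul_zero := fun _ => rfl
      mul_assoc := fun _ _ _ => rfl
      mul_comm := fun _ _ => rfl }
  { carrier := M
    isScalarTower := ⟨fun r _ _ => (smul_zero r).symm⟩
    smulCommClass := ⟨fun r _ _ => smul_zero r⟩
    nilpotent := ⟨1, fun _ => rfl⟩ }

lemma ofModule_mul (M : Type u) [AddCommGroup M] [Module R M]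
    (x y : (ofModule (R := R) M).carrier) : x * y = 0 := rfl

/-- An injective homomorphism into a square-zero algebra is the kernel of a homomorphism onto
a square-zero algebra. -/
lemma exists_isSES_of_sq_zero {N M : NilpAlg R} (i : N.carrier →ₙₐ[R] M.carrier)
    (hi : Function.Injective i) (hM : ∀ x y : M.carrier, x * y = 0) :
    ∃ (C : NilpAlg R) (p : M.carrier →ₙₐ[R] C.carrier), (∀ x y : C.carrier, x * y = 0) ∧
      IsSES i p := by
  let S : Submodule R M.carrier := LinearMap.range (i : N.carrier →ₗ[R] M.carrier)
  refine ⟨ofModule (M.carrier ⧸ S),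
    { toFun := S.mkQ
      map_smul' := S.mkQ.map_smul
      map_zero' := S.mkQ.map_zero
      map_add' := S.mkQ.map_add
      map_mul' := fun x y => by rw [hM, map_zero]; rfl }, ofModule_mul _, hi, S.mkQ_surjective,
    fun x => ?_⟩
  exact Submodule.Quotient.mk_eq_zero S

section Rat

noncomputable instance tensorNonUnitalCommRing (A : Type*) [NonUnitalCommRing A] :
    NonUnitalCommRing (A ⊗[ℤ] ℚ) :=
  { (inferInstance : AddCommGroup (A ⊗[ℤ] ℚ)), (inferInstance : NonUnitalRing (A ⊗[ℤ] ℚ)) with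
    mul_comm := fun x y => by
      have h : Algebra.TensorProduct.mul (R := ℤ) (A := A) (B := ℚ) =
          Algebra.TensorProduct.mul.flip := by
        ext a b
        simp [mul_comm]
      exact LinearMap.congr_fun₂ h x y }

lemma nprod_tensor_eq_zero {A : Type*} [NonUnitalCommRing A] {k : ℕ}
    (h : ∀ f : Fin (k + 1) → A, nprod k f = 0) (f : Fin (k + 1) → A ⊗[ℤ] ℚ) : nprod k f = 0 := by
  suffices H : ∀ L : A ⊗[ℤ] ℚ →+ A ⊗[ℤ] ℚ,
      (∀ (g : Fin (k + 1) → A) (q : ℚ), L (nprod k g ⊗ₜ q) = 0) → L (nprod k f) = 0 from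
    H (AddMonoidHom.id _) fun g q => by simp [h]
  clear h
  induction k with
  | zero =>
    intro L hL
    change L (f 0) = 0
    induction f 0 using TensorProduct.induction_on with
    | zero => simp
    | tmul a q => exact hL (fun _ => a) q
    | add x y hx hy => rw [map_add, hx, hy, add_zero]
  | succ k ih =>
    intro L hL
    change L (f 0 * nprod k _) = 0
    induction f 0 using TensorProduct.induction_on with
    | zero => simp
    | tmul a q =>
      refine ih (fun j => f j.succ) (L.comp (AddMonoidHom.mulLeft (a ⊗ₜ q))) fun g r => ?_
      have := hL (Fin.cons a g) (q * r)
      simpa [nprod] using this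
    | add x y hx hy => rw [add_mul, map_add, hx, hy, add_zero]

/-- The rationalisation `N ⊗ ℚ` of a nilpotent algebra. -/
noncomputable def rat (N : NilpAlg R) : NilpAlg R :=
  { carrier := N.carrier ⊗[ℤ] ℚ
    isScalarTower := ⟨fun r x y => by
        simp only [smul_eq_mul]
        induction x using TensorProduct.induction_on with
        | zero => simp
        | add x₁ x₂ h₁ h₂ => simp only [smul_add, add_mul, h₁, h₂]
        | tmul a q =>
          induction y using TensorProduct.induction_on with
          | zero => simp
          | add y₁ y₂ h₁ h₂ => simp only [smul_add, mul_add, h₁, h₂]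
          | tmul b s => simp [TensorProduct.smul_tmul', smul_mul_assoc]⟩
    smulCommClass := ⟨fun r x y => by
        simp only [smul_eq_mul]
        induction x using TensorProduct.induction_on with
        | zero => simp
        | add x₁ x₂ h₁ h₂ => simp only [smul_add, add_mul, h₁, h₂]
        | tmul a q =>
          induction y using TensorProduct.induction_on with
          | zero => simp
          | add y₁ y₂ h₁ h₂ => simp only [smul_add, mul_add, h₁, h₂]
          | tmul b s => simp [TensorProduct.smul_tmul', mul_smul_comm]⟩
    nilpotent := by
      obtain ⟨k, hk⟩ := N.nilpotent
      exact ⟨k, nprod_tensor_eq_zero hk⟩ }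

lemma isQVectorSpace_rat (N : NilpAlg R) : IsQVectorSpace N.rat.carrier := by
  intro n hn
  have hn' : (n : ℚ) ≠ 0 := by exact_mod_cast hn
  let m : N.carrier ⊗[ℤ] ℚ →ₗ[ℤ] N.carrier ⊗[ℤ] ℚ :=
    LinearMap.lTensor N.carrier (LinearMap.mulLeft ℤ (n : ℚ)⁻¹)
  have key : ∀ x, m (n • x) = x := fun x => by
    induction x using TensorProduct.induction_on with
    | zero => simp
    | add x y hx hy => rw [smul_add, map_add, hx, hy]
    | tmul a q =>
      rw [← TensorProduct.tmul_smul]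
      refine (LinearMap.lTensor_tmul _ _ _ _).trans ?_
      rw [LinearMap.mulLeft_apply, zsmul_eq_mul, inv_mul_cancel_left₀ hn']
  refine Function.bijective_iff_has_inverse.2 ⟨m, key, fun x => ?_⟩
  exact (map_zsmul m n x).symm.trans (key x)

/-- Functoriality of the rationalisation. -/
noncomputable def ratMap {N M : NilpAlg R} (f : N.carrier →ₙₐ[R] M.carrier) :
    N.rat.carrier →ₙₐ[R] M.rat.carrier :=
  let φ : N.carrier ⊗[ℤ] ℚ →+ M.carrier ⊗[ℤ] ℚ :=
    (LinearMap.rTensor ℚ (f : N.carrier →+ M.carrier).toIntLinearMap).toAddMonoidHom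
  { toFun := φ
    map_zero' := map_zero φ
    map_add' := map_add φ
    map_smul' := fun r (x : N.carrier ⊗[ℤ] ℚ) => by
      change φ (r • x) = r • φ x
      induction x using TensorProduct.induction_on with
      | zero => simp
      | add x y hx hy => rw [smul_add, map_add, map_add, smul_add, hx, hy]
      | tmul a q => simp [φ, TensorProduct.smul_tmul']
    map_mul' := fun (x y : N.carrier ⊗[ℤ] ℚ) => by
      change φ (x * y) = φ x * φ y
      induction x using TensorProduct.induction_on with
      | zero => simp
      | add x₁ x₂ h₁ h₂ => simp only [map_add, add_mul, h₁, h₂]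
      | tmul a q =>
        induction y using TensorProduct.induction_on with
        | zero => simp
        | add y₁ y₂ h₁ h₂ => simp only [map_add, mul_add, h₁, h₂]
        | tmul b s => simp [φ] }

/-- The canonical map to the rationalisation. -/
noncomputable def toRat (N : NilpAlg R) : N.carrier →ₙₐ[R] N.rat.carrier where
  toFun x := (x ⊗ₜ[ℤ] (1 : ℚ) : N.carrier ⊗[ℤ] ℚ)
  map_smul' _ _ := rfl
  map_zero' := TensorProduct.zero_tmul _ _
  map_add' _ _ := TensorProduct.add_tmul _ _ _
  map_mul' x y := by
    change _ = (x ⊗ₜ[ℤ] (1 : ℚ) : N.carrier ⊗[ℤ] ℚ) * y ⊗ₜ[ℤ] (1 : ℚ)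
    simp

lemma ratMap_comp_toRat {N M : NilpAlg R} (f : N.carrier →ₙₐ[R] M.carrier) :
    (ratMap f).comp N.toRat = M.toRat.comp f :=
  NonUnitalAlgHom.ext fun _ => LinearMap.rTensor_tmul _ _ _ _

lemma toRat_injective (N : NilpAlg R) [Module.IsTorsionFree ℤ N.carrier] :
    Function.Injective N.toRat := by
  have h := Module.Flat.lTensor_preserves_injective_linearMap (M := N.carrier)
    (Algebra.linearMap ℤ ℚ) (algebraMap ℤ ℚ).injective_int
  intro x y hxy
  apply (TensorProduct.rid ℤ N.carrier).symm.injective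
  apply h
  simpa using show (x ⊗ₜ[ℤ] (1 : ℚ) : N.carrier ⊗[ℤ] ℚ) = y ⊗ₜ[ℤ] (1 : ℚ) from hxy

lemma isSES_ratMap {N₁ N₂ N₃ : NilpAlg R} {i : N₁.carrier →ₙₐ[R] N₂.carrier}
    {p : N₂.carrier →ₙₐ[R] N₃.carrier} (h : IsSES i p) : IsSES (ratMap i) (ratMap p) :=
  ⟨Module.Flat.rTensor_preserves_injective_linearMap (M := ℚ)
      (i : N₁.carrier →+ N₂.carrier).toIntLinearMap h.1,
    LinearMap.rTensor_surjective ℚ (g := (p : N₂.carrier →+ N₃.carrier).toIntLinearMap) h.2.1,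
    rTensor_exact ℚ (f := (i : N₁.carrier →+ N₂.carrier).toIntLinearMap)
      (g := (p : N₂.carrier →+ N₃.carrier).toIntLinearMap) h.2.2 h.2.1⟩

lemma rat_mul_eq_zero {N : NilpAlg R} (h : ∀ x y : N.carrier, x * y = 0) (x y : N.rat.carrier) :
    x * y = 0 :=
  nprod_tensor_eq_zero (A := N.carrier) (k := 1) (fun _ => h _ _) ![x, y]

end Rat

/-- The quotient of an algebra by its annihilator, realised as multiplication operators. -/
def modAnn (N : NilpAlg R) : NilpAlg R :=
  let S := NonUnitalAlgHom.range (NonUnitalAlgHom.lmul R N.carrier)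
  letI : NonUnitalCommRing S :=
    { (inferInstance : NonUnitalRing S) with
      mul_comm := by
        rintro ⟨_, a, rfl⟩ ⟨_, b, rfl⟩
        ext x
        exact mul_left_comm a b x }
  { carrier := S
    nilpotent := by
      obtain ⟨k, hk⟩ := N.nilpotent
      refine ⟨k, fun f => ?_⟩
      choose g hg using fun j => (f j).2
      refine Subtype.ext ?_
      refine (map_nprod (NonUnitalSubalgebraClass.subtype (R := R) S) k f).trans ?_
      rw [show (fun j => NonUnitalSubalgebraClass.subtype (R := R) S (f j)) =
        fun j => NonUnitalAlgHom.lmul R N.carrier (g j) from funext fun j => (hg j).symm,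
        ← map_nprod, hk, map_zero]
      rfl }

/-- The projection onto the quotient by the annihilator. -/
def toModAnn (N : NilpAlg R) : N.carrier →ₙₐ[R] N.modAnn.carrier :=
  NonUnitalAlgHom.rangeRestrict (NonUnitalAlgHom.lmul R N.carrier)

lemma toModAnn_surjective (N : NilpAlg R) : Function.Surjective N.toModAnn := by
  rintro ⟨_, a, rfl⟩
  exact ⟨a, rfl⟩

lemma toModAnn_eq_zero {N : NilpAlg R} {x : N.carrier} :
    N.toModAnn x = 0 ↔ ∀ y, x * y = 0 :=
  ⟨fun h y => LinearMap.congr_fun (congr_arg Subtype.val h) y,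
    fun h => Subtype.ext (LinearMap.ext h)⟩

lemma isTorsionFree_of_injective {A B : Type*} [AddCommGroup A] [AddCommGroup B]
    [Module.IsTorsionFree ℤ B] (f : A →+ B) (hf : Function.Injective f) :
    Module.IsTorsionFree ℤ A :=
  hf.moduleIsTorsionFree f fun n x => map_zsmul f n x

instance (N : NilpAlg R) [Module.IsTorsionFree ℤ N.carrier] :
    Module.IsTorsionFree ℤ N.modAnn.carrier := by
  let φ : N.modAnn.carrier →+ (N.carrier → N.carrier) :=
    { toFun := fun s => ⇑s.1
      map_zero' := rfl
      map_add' := fun _ _ => rfl }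
  exact isTorsionFree_of_injective φ fun a b h => Subtype.ext (DFunLike.coe_injective h)

instance {N M : NilpAlg R} (p : N.carrier →ₙₐ[R] M.carrier) [Module.IsTorsionFree ℤ N.carrier] :
    Module.IsTorsionFree ℤ (ker p).carrier :=
  isTorsionFree_of_injective (kerι p : (ker p).carrier →+ N.carrier) (kerι_injective p)

section Cover

open MvPolynomial

lemma coe_nprod_mem_pow {A : Type*} [CommRing A] (I : Ideal A) (k : ℕ) (f : Fin (k + 1) → I) :
    ((nprod k f : I) : A) ∈ I ^ (k + 1) := by
  induction k with
  | zero => simp [nprod]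
  | succ k ih =>
    rw [pow_succ']
    exact Ideal.mul_mem_mul (f 0).2 (ih _)

variable (R) in
/-- The free nilpotent algebra on `σ` of class `k`. -/
noncomputable def free (σ : Type u) (k : ℕ) : NilpAlg R where
  carrier := (idealOfVars σ R).map (Ideal.Quotient.mk (idealOfVars σ R ^ (k + 1)))
  isScalarTower := ⟨fun r a b => Subtype.ext (smul_mul_assoc r a.1 b.1)⟩
  smulCommClass := ⟨fun r a b => Subtype.ext (mul_smul_comm r a.1 b.1).symm⟩
  nilpotent := by
    refine ⟨k, fun f => Subtype.ext ?_⟩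
    have h := coe_nprod_mem_pow _ k f
    rwa [← Ideal.map_pow, Ideal.map_quotient_self, Ideal.mem_bot] at h

lemma isTorsionFree_free (hR : ∀ (n : ℤ) (r : R), n ≠ 0 → n • r = 0 → r = 0) (σ : Type u) (k : ℕ) :
    Module.IsTorsionFree ℤ (free R σ k).carrier := by
  refine .of_smul_eq_zero fun n x hx => or_iff_not_imp_left.2 fun hn => Subtype.ext ?_
  obtain ⟨p, hp⟩ := Ideal.Quotient.mk_surjective x.1
  have hx' : n • x.1 = 0 := congr_arg Subtype.val hx
  rw [← hp, ← map_zsmul, Ideal.Quotient.eq_zero_iff_mem, mem_pow_idealOfVars_iff'] at hx'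
  change x.1 = 0
  rw [← hp, Ideal.Quotient.eq_zero_iff_mem, mem_pow_idealOfVars_iff']
  exact fun d hd => hR n _ hn (by rw [← coeff_smul]; exact hx' d hd)

lemma ker_fstHom_pow_eq_bot {A : Type*} [NonUnitalCommRing A] [Module R A] [IsScalarTower R A A]
    [SMulCommClass R A A] {k : ℕ} (h : ∀ f : Fin (k + 1) → A, nprod k f = 0) :
    RingHom.ker (Unitization.fstHom R A) ^ (k + 1) = ⊥ := by
  suffices H : ∀ z : Unitization R A,
      (∀ f : Fin (k + 1) → A, ((nprod k f : A) : Unitization R A) * z = 0) →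
      ∀ x ∈ RingHom.ker (Unitization.fstHom R A) ^ (k + 1), x * z = 0 from
    (Submodule.eq_bot_iff _).2 fun x hx => by simpa using H 1 (fun f => by simp [h]) x hx
  have hinr : ∀ x ∈ RingHom.ker (Unitization.fstHom R A), ∃ a : A, x = a := fun x hx =>
    ⟨x.snd, Unitization.ext hx rfl⟩
  clear h
  induction k with
  | zero =>
    intro z hz x hx
    rw [zero_add, pow_one] at hx
    obtain ⟨a, rfl⟩ := hinr x hx
    exact hz fun _ => a
  | succ k ih =>
    intro z hz x hx
    rw [pow_succ'] at hx
    induction hx using Submodule.mul_induction_on' with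
    | add x _ y _ hx hy => rw [add_mul, hx, hy, add_zero]
    | mem_mul_mem x hx y hy =>
      obtain ⟨a, rfl⟩ := hinr x hx
      rw [mul_assoc, mul_left_comm]
      refine ih (a * z) (fun f => ?_) y hy
      rw [mul_left_comm, ← mul_assoc, ← Unitization.inr_mul]
      exact hz (Fin.cons a f)

lemma exists_free_surjective (N : NilpAlg R) :
    ∃ (k : ℕ) (p : (free R N.carrier k).carrier →ₙₐ[R] N.carrier), Function.Surjective p := by
  obtain ⟨k, hk⟩ := N.nilpotent
  let ev : MvPolynomial N.carrier R →ₐ[R] Unitization R N.carrier :=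
    aeval fun x => (x : Unitization R N.carrier)
  have hev : (idealOfVars N.carrier R).map ev ≤ RingHom.ker (Unitization.fstHom R N.carrier) := by
    rw [Ideal.map_le_iff_le_comap, Ideal.span_le]
    rintro _ ⟨x, rfl⟩
    simp [ev, RingHom.mem_ker]
  have hev' : ∀ a ∈ idealOfVars N.carrier R ^ (k + 1), ev a = 0 := fun a ha => by
    rw [← Ideal.mem_bot, ← ker_fstHom_pow_eq_bot hk]
    refine Ideal.pow_right_mono hev _ ?_
    rw [← Ideal.map_pow]
    exact Ideal.mem_map_of_mem _ ha
  let φ := Ideal.Quotient.liftₐ _ ev hev'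
  have hφ : ∀ a : (free R N.carrier k).carrier, (φ a.1).fst = 0 := by
    rintro ⟨a, ha⟩
    obtain ⟨b, hb, rfl⟩ := (Ideal.mem_map_iff_of_surjective _ Ideal.Quotient.mk_surjective).1 ha
    exact hev (Ideal.mem_map_of_mem _ hb)
  refine ⟨k,
    { toFun := fun a => (φ a.1).snd
      map_smul' := fun r a => congr_arg (fun z => z.snd) (map_smul φ r a.1)
      map_zero' := congr_arg (fun z => z.snd) (map_zero φ)
      map_add' := fun a b => congr_arg (fun z => z.snd) (map_add φ a.1 b.1)
      map_mul' := fun a b => (congr_arg (fun z => z.snd) (map_mul φ a.1 b.1)).trans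
        (by simp [hφ]) }, fun x => ?_⟩
  refine ⟨⟨Ideal.Quotient.mk _ (X x), Ideal.mem_map_of_mem _ (Ideal.subset_span ⟨x, rfl⟩)⟩, ?_⟩
  change (ev (X x)).snd = x
  simp [ev]

end Cover

end NilpAlg

namespace AbFunctor

open NilpAlg

variable {Φ : AbFunctor.{u, v} R}

lemma map_map (Φ : AbFunctor.{u, v} R) {A B C D : NilpAlg R} {f : A.carrier →ₙₐ[R] B.carrier}
    {g : B.carrier →ₙₐ[R] D.carrier} {f' : A.carrier →ₙₐ[R] C.carrier}
    {g' : C.carrier →ₙₐ[R] D.carrier} (h : g.comp f = g'.comp f') (x : Φ.obj A) :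
    Φ.map g (Φ.map f x) = Φ.map g' (Φ.map f' x) := by
  rw [← AddMonoidHom.comp_apply, ← map_comp, h, map_comp, AddMonoidHom.comp_apply]

lemma map_toRat_injective_of_sq_zero
    (hsq : Φ.ExactOn fun N => ∀ x y : N.carrier, x * y = 0)
    (N : NilpAlg R) [Module.IsTorsionFree ℤ N.carrier] (hN : ∀ x y : N.carrier, x * y = 0) :
    Function.Injective (Φ.map N.toRat) := by
  obtain ⟨C, p, hC, h⟩ := exists_isSES_of_sq_zero N.toRat N.toRat_injective (rat_mul_eq_zero hN)
  exact (hsq hN (rat_mul_eq_zero hN) hC _ _ h).1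

lemma obj_eq_zero (hre : Φ.RightExact) {N : NilpAlg R} (hN : ∀ x : N.carrier, x = 0)
    (x : Φ.obj N) : x = 0 := by
  have h : IsSES (NonUnitalAlgHom.id R N.carrier) (NonUnitalAlgHom.id R N.carrier) :=
    ⟨fun _ _ h => h, fun x => ⟨x, rfl⟩, fun x => ⟨fun _ => ⟨x, rfl⟩, fun _ => hN _⟩⟩
  simpa [Φ.map_id] using ((hre _ _ h).2 x).2

lemma map_toRat_injective (hre : Φ.RightExact) (hQ : Φ.ExactOn fun N => IsQVectorSpace N.carrier)
    (hsq : Φ.ExactOn fun N => ∀ x y : N.carrier, x * y = 0)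
    (N : NilpAlg R) [Module.IsTorsionFree ℤ N.carrier] :
    Function.Injective (Φ.map N.toRat) := by
  obtain ⟨k, hk⟩ := N.nilpotent
  induction k generalizing N with
  | zero =>
    have h := obj_eq_zero hre fun z => hk fun _ => z
    exact fun x y _ => (h x).trans (h y).symm
  | succ k ih =>
    have hses := isSES_ker N.toModAnn_surjective
    have hM : ∀ f : Fin (k + 1) → N.modAnn.carrier, nprod k f = 0 := fun f => by
      choose g hg using fun j => N.toModAnn_surjective (f j)
      obtain rfl : (fun j => N.toModAnn (g j)) = f := funext hg
      rw [← map_nprod, toModAnn_eq_zero]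
      intro y
      rw [mul_comm]
      exact hk (Fin.cons y g)
    have hker : ∀ x y : (ker N.toModAnn).carrier, x * y = 0 := fun x y =>
      Subtype.ext (toModAnn_eq_zero.1 x.2 y.1)
    rw [injective_iff_map_eq_zero]
    intro x hx
    have h0 : Φ.map N.toModAnn x = 0 := by
      apply (injective_iff_map_eq_zero _).1 (ih N.modAnn hM)
      rw [← Φ.map_map (ratMap_comp_toRat N.toModAnn), hx, map_zero]
    obtain ⟨y, rfl⟩ := ((hre _ _ hses).2 x).1 h0
    have hinj := (hQ (isQVectorSpace_rat _) (isQVectorSpace_rat _) (isQVectorSpace_rat _) _ _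
      (isSES_ratMap hses)).1
    rw [← Φ.map_map (ratMap_comp_toRat (kerι N.toModAnn))] at hx
    rw [(injective_iff_map_eq_zero _).1 (map_toRat_injective_of_sq_zero hsq _ hker) y
      ((injective_iff_map_eq_zero _).1 hinj _ hx), map_zero]

lemma map_kerι_injective_of_isTorsionFree (hre : Φ.RightExact)
    (hQ : Φ.ExactOn fun N => IsQVectorSpace N.carrier)
    (hsq : Φ.ExactOn fun N => ∀ x y : N.carrier, x * y = 0)
    {N M : NilpAlg R} [Module.IsTorsionFree ℤ N.carrier] {p : N.carrier →ₙₐ[R] M.carrier}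
    (hp : Function.Surjective p) : Function.Injective (Φ.map (kerι p)) := by
  have hinj := (hQ (isQVectorSpace_rat _) (isQVectorSpace_rat _) (isQVectorSpace_rat _) _ _
    (isSES_ratMap (isSES_ker hp))).1
  intro x y hxy
  apply map_toRat_injective hre hQ hsq (ker p)
  apply hinj
  rw [Φ.map_map (ratMap_comp_toRat (kerι p)), hxy, Φ.map_map (ratMap_comp_toRat (kerι p))]

end AbFunctor

open NilpAlg AbFunctor

theorem stmt3 (R : Type u) [CommRing R]
    (hR : ∀ (n : ℤ) (r : R), n ≠ 0 → n • r = 0 → r = 0)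
    (Φ : AbFunctor.{u, v} R) (hre : Φ.RightExact)
    (hQ : Φ.ExactOn fun N => IsQVectorSpace N.carrier)
    (hsq : Φ.ExactOn fun N => ∀ x y : N.carrier, x * y = 0) :
    Φ.ExactOn fun _ => True := by
  intro N₁ N₂ N₃ _ _ _ i p h
  refine ⟨?_, hre i p h⟩
  obtain ⟨k, π, hπ⟩ := exists_free_surjective N₂
  have := isTorsionFree_free hR N₂.carrier k
  have hI : Function.Surjective (p.comp π) := h.2.1.comp hπ
  obtain ⟨q, hq⟩ := exists_lift h.1 (π.comp (kerι (p.comp π))) fun a => (h.2.2 _).1 a.2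
  obtain ⟨j, hj⟩ := exists_lift (kerι_injective (p.comp π)) (kerι π) fun a =>
    (mem_range_kerι _ _).1 ((congr_arg p a.2).trans (map_zero p))
  have hqs : Function.Surjective q := fun x => by
    obtain ⟨f, hf⟩ := hπ (i x)
    have hf' : p.comp π f = 0 := (congr_arg p hf).trans ((h.2.2 _).2 ⟨x, rfl⟩)
    exact ⟨⟨f, hf'⟩, h.1 ((DFunLike.congr_fun hq _).trans hf)⟩
  have hqj : ∀ y, Φ.map q (Φ.map j y) = 0 := fun y => by
    have hses : IsSES j q := by
      refine ⟨fun a b hab => kerι_injective π ?_, hqs, fun x => ?_⟩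
      · rw [← hj, NonUnitalAlgHom.comp_apply, NonUnitalAlgHom.comp_apply, hab]
      · rw [← map_eq_zero_iff i h.1, ← NonUnitalAlgHom.comp_apply, hq,
          NonUnitalAlgHom.comp_apply, mem_range_kerι, ← hj]
        exact ⟨fun ⟨y, hy⟩ => ⟨y, kerι_injective _ hy⟩, fun ⟨y, hy⟩ => ⟨y, congr_arg (kerι _) hy⟩⟩
    exact ((hre j q hses).2 _).2 ⟨y, rfl⟩
  have hqΦ : Function.Surjective (Φ.map q) := (hre _ _ (isSES_ker hqs)).1
  rw [injective_iff_map_eq_zero]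
  intro x hx
  obtain ⟨x, rfl⟩ := hqΦ x
  rw [Φ.map_map hq] at hx
  obtain ⟨y, hy⟩ := ((hre _ _ (isSES_ker hπ)).2 _).1 hx
  obtain rfl : Φ.map j y = x := by
    apply map_kerι_injective_of_isTorsionFree hre hQ hsq hI
    rw [← hy, ← AddMonoidHom.comp_apply, ← Φ.map_comp, hj]
  exact hqj y
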